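/- Let s ≤ 0 ≤ t be integers, let p, q ∈ ℝ² with dist(p,q) = 1, and let d be a unit vector such that the angle between the segment [p,q] and d is strictly less than arccos(1/4). Then the chain graph C(s,t) admits a planar straight-line drawing ρ with ρ(a) = p and ρ(b) = q such that: (i) the closed segment of every edge is contained in the strip S([p,q], d); (ii) for every external edge e' other than {a,b}, the segment of e' under ρ is not parallel to d, and the strip S over that segment in direction d intersects the union of the segments of all edges of C(s,t) only in the segment of e' itself; (iii) every external edge has length exactly 1 and every non-external edge has length strictly greater than 1/2; (iv) every external edge forms an angle strictly less than arccos(1/4) with d. -/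

import Mathlib

noncomputable section

/-- The Euclidean plane. -/
abbrev Plane : Type := EuclideanSpace ℝ (Fin 2)

/-- A planar straight-line drawing of a simple graph `G`. -/
def IsPlanarDrawing {V : Type} (G : SimpleGraph V) (ρ : V → Plane) : Prop :=
  Function.Injective ρ ∧
  (∀ u v w : V, G.Adj u v → w ≠ u → w ≠ v → ρ w ∉ segment ℝ (ρ u) (ρ v)) ∧
  (∀ u v x y : V, G.Adj u v → G.Adj x y → s(u, v) ≠ s(x, y) →
    segment ℝ (ρ u) (ρ v) ∩ segment ℝ (ρ x) (ρ y) =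
      {p : Plane | ∃ w : V, (w = u ∨ w = v) ∧ (w = x ∨ w = y) ∧ p = ρ w})

/-- Vertices of the chain graph `C(s,t)`: `a = Sum.inl false`, `b = Sum.inl true`, and
`v_i = Sum.inr i` for `i ∈ {s, …, −1} ∪ {1, …, t+1}`. -/
abbrev CVert (s t : ℤ) : Type := Bool ⊕ {i : ℤ // s ≤ i ∧ i ≤ t + 1 ∧ i ≠ 0}

/-- The vertex `v_i` (junk value `b` if `i` is out of range). -/
def cv (s t : ℤ) (i : ℤ) : CVert s t :=
  if h : s ≤ i ∧ i ≤ t + 1 ∧ i ≠ 0 then Sum.inr ⟨i, h⟩ else Sum.inl true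

/-- `u_j`: `u_0 = b` and `u_j = v_j` for `j ≥ 1`. -/
def cu (s t : ℤ) (j : ℤ) : CVert s t := if j = 0 then Sum.inl true else cv s t j

/-- `w_j`: `w_0 = a`, and `w_j = v_j` otherwise (in particular `w_1 = v_1`). -/
def cw (s t : ℤ) (j : ℤ) : CVert s t := if j = 0 then Sum.inl false else cv s t j

/-- The triangle `T_i` of the chain `C(s,t)` (as a set of vertices):
`T_0 = {a, b, v₁}`; for `i ≥ 1`, `T_i = {u_{i−1}, v_i, v_{i+1}}`; for `i ≤ −1`,
`T_i = {v_i, w_{i+1}, w_{i+2}}`. -/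
def chainTri (s t : ℤ) (i : ℤ) : Set (CVert s t) :=
  if i = 0 then {Sum.inl false, Sum.inl true, cv s t 1}
  else if 0 < i then {cu s t (i - 1), cv s t i, cv s t (i + 1)}
  else {cv s t i, cw s t (i + 1), cw s t (i + 2)}

/-- The chain graph `C(s,t)`: two distinct vertices are adjacent exactly when they lie in
a common triangle `T_i`, `s ≤ i ≤ t`. -/
def chainGraph (s t : ℤ) : SimpleGraph (CVert s t) :=
  SimpleGraph.fromRel fun x y =>
    ∃ i : ℤ, s ≤ i ∧ i ≤ t ∧ x ∈ chainTri s t i ∧ y ∈ chainTri s t i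

/-- The external edges of `C(s,t)`: `{a,b}`, the edges `{u_{i−1}, v_{i+1}}` for
`1 ≤ i ≤ t`, and the edges `{v_i, w_{i+2}}` for `s ≤ i ≤ −1`. -/
def IsExtEdge (s t : ℤ) (x y : CVert s t) : Prop :=
  s(x, y) = s(Sum.inl false, (Sum.inl true : CVert s t)) ∨
  (∃ i : ℤ, 1 ≤ i ∧ i ≤ t ∧ s(x, y) = s(cu s t (i - 1), cv s t (i + 1))) ∨
  (∃ i : ℤ, s ≤ i ∧ i ≤ -1 ∧ s(x, y) = s(cv s t i, cw s t (i + 2)))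

/-- The half-infinite strip over the segment `[p,q]` in direction `d`. -/
def strip (p q d : Plane) : Set Plane :=
  {x : Plane | ∃ y ∈ segment ℝ p q, ∃ r : ℝ, 0 ≤ r ∧ x = y + r • d}

/-- The angle between the segment `[p,q]` and a direction `d`: the minimum of the angles
between `d` and `q − p` and between `d` and `p − q`. -/
def segAngle (p q d : Plane) : ℝ :=
  min (InnerProductGeometry.angle d (q - p)) (InnerProductGeometry.angle d (p - q))

/-- The union of the closed segments of all edges of a drawing. -/
def drawnEdgeSet {V : Type} (G : SimpleGraph V) (ρ : V → Plane) : Set Plane :=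
  ⋃ (e : V × V) (_ : G.Adj e.1 e.2), segment ℝ (ρ e.1) (ρ e.2)

/-! ### Segments, strips and linear functionals -/

lemma eq_right_of_mem_segment {φ : Plane →ₗ[ℝ] ℝ} {c : ℝ} {u v x : Plane}
    (hx : x ∈ segment ℝ u v) (hu : φ u < c) (hv : φ v ≤ c) (hc : c ≤ φ x) :
    x = v ∧ φ v = c := by
  obtain ⟨a, b, ha, hb, hab, rfl⟩ := hx
  simp only [map_add, map_smul, smul_eq_mul] at hc
  have ha0 : a = 0 := by
    by_contra h
    have : 0 < a := lt_of_le_of_ne ha (Ne.symm h)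
    obtain rfl : b = 1 - a := by linarith
    nlinarith [mul_pos this (sub_pos.2 hu), mul_nonneg hb (sub_nonneg.2 hv)]
  obtain rfl : b = 1 := by linarith
  subst ha0
  refine ⟨by simp, by linarith⟩

lemma eq_right_of_mem_segment' {φ : Plane →ₗ[ℝ] ℝ} {c : ℝ} {u v x : Plane}
    (hx : x ∈ segment ℝ u v) (hu : c < φ u) (hv : c ≤ φ v) (hc : φ x ≤ c) :
    x = v ∧ φ v = c := by
  have := eq_right_of_mem_segment (φ := -φ) (c := -c) hx (by simpa using hu) (by simpa using hv)
    (by simpa using hc)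
  exact ⟨this.1, by simpa using this.2⟩

lemma le_of_mem_segment {φ : Plane →ₗ[ℝ] ℝ} {c : ℝ} {u v x : Plane}
    (hx : x ∈ segment ℝ u v) (hu : φ u ≤ c) (hv : φ v ≤ c) : φ x ≤ c := by
  obtain ⟨a, b, ha, hb, hab, rfl⟩ := hx
  simp only [map_add, map_smul, smul_eq_mul]
  obtain rfl : b = 1 - a := by linarith
  nlinarith [mul_nonneg ha (sub_nonneg.2 hu), mul_nonneg hb (sub_nonneg.2 hv)]

lemma segment_subset_strip (p q d : Plane) : segment ℝ p q ⊆ strip p q d :=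
  fun x hx => ⟨x, hx, 0, le_rfl, by simp⟩

lemma strip_symm (p q d : Plane) : strip p q d = strip q p d := by
  simp only [strip, segment_symm ℝ p q]

lemma convex_strip (p q d : Plane) : Convex ℝ (strip p q d) := by
  rintro _ ⟨y, hy, r, hr, rfl⟩ _ ⟨y', hy', r', hr', rfl⟩ a b ha hb hab
  refine ⟨a • y + b • y', convex_segment p q hy hy' ha hb hab, a * r + b * r', by positivity, ?_⟩
  module

lemma le_of_mem_strip {φ : Plane →ₗ[ℝ] ℝ} {c : ℝ} {u v d x : Plane}
    (hx : x ∈ strip u v d) (hd : 0 ≤ φ d) (hu : c ≤ φ u) (hv : c ≤ φ v) : c ≤ φ x := by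
  obtain ⟨_, ⟨a, b, ha, hb, hab, rfl⟩, r, hr, rfl⟩ := hx
  simp only [map_add, map_smul, smul_eq_mul]
  obtain rfl : b = 1 - a := by linarith
  nlinarith [mul_nonneg hr hd, mul_nonneg ha (sub_nonneg.2 hu), mul_nonneg hb (sub_nonneg.2 hv)]

lemma eq_right_of_mem_strip {φ : Plane →ₗ[ℝ] ℝ} {c : ℝ} {u v d x : Plane}
    (hx : x ∈ strip u v d) (hd : 0 < φ d) (hu : c < φ u) (hv : c ≤ φ v) (hc : φ x ≤ c) :
    x = v := by
  obtain ⟨y, hy, r, hr, rfl⟩ := hx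
  have hy' : c ≤ φ y := le_of_mem_strip (segment_subset_strip u v d hy) hd.le hu.le hv
  simp only [map_add, map_smul, smul_eq_mul] at hc
  have hr0 : r = 0 := by
    by_contra h
    have : 0 < r := lt_of_le_of_ne hr (Ne.symm h)
    nlinarith [mul_pos this hd]
  subst hr0
  simpa using (eq_right_of_mem_segment' hy hu hv (by simpa using hc)).1

/-! ### Zigzags -/

/-- A sequence of points such that the line through two consecutive points has all earlier
points below it and all later points above it, and such that a line parallel to `d` through
`z (j + 2)` has `z j` on one side and all other `z m` with `j - 1 ≤ m ≤ hi` on the other. -/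
structure IsZigzag (d : Plane) (lo hi : ℤ) (z : ℤ → Plane) : Prop where
  line : ∀ j, lo ≤ j → j ≤ hi → ∃ (φ : Plane →ₗ[ℝ] ℝ) (c : ℝ), 0 < φ d ∧ φ (z j) = c ∧
    φ (z (j + 1)) = c ∧ (∀ m, m < j → φ (z m) < c) ∧ ∀ m, j + 1 < m → c < φ (z m)
  wall : ∀ j, lo ≤ j → j ≤ hi → ∃ (φ : Plane →ₗ[ℝ] ℝ) (c : ℝ), φ d = 0 ∧ c < φ (z j) ∧
    φ (z (j + 2)) = c ∧
    ∀ m, j - 1 ≤ m → m ≤ hi → m ≠ j → m ≠ j + 2 → φ (z m) < c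

namespace IsZigzag

variable {d : Plane} {lo hi : ℤ} {z : ℤ → Plane}

lemma ne_of_lt (hz : IsZigzag d lo hi z) {i j : ℤ} (hj : lo ≤ j) (hj' : j ≤ hi) (hij : i < j) :
    z i ≠ z j := by
  obtain ⟨φ, c, -, h0, -, hlt, -⟩ := hz.line j hj hj'
  intro h
  have := hlt i hij
  rw [h, h0] at this
  exact lt_irrefl _ this

lemma eq_of_eq (hz : IsZigzag d lo hi z) {i j : ℤ} (hi0 : lo ≤ i) (hi' : i ≤ hi) (hj : lo ≤ j)
    (hj' : j ≤ hi) (h : z i = z j) : i = j := by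
  rcases lt_trichotomy i j with hl | hl | hl
  · exact absurd h (hz.ne_of_lt hj hj' hl)
  · exact hl
  · exact absurd h.symm (hz.ne_of_lt hi0 hi' hl)

lemma inter (hz : IsZigzag d lo hi z) {i i' j j' : ℤ} {x : Plane}
    (hii : i' = i + 1 ∨ i' = i + 2) (hjj : j' = j + 1 ∨ j' = j + 2)
    (hi0 : lo ≤ i) (hi1 : i' ≤ hi) (hj0 : lo ≤ j) (hj1 : j' ≤ hi)
    (hne : ¬ (i = j ∧ i' = j'))
    (hx : x ∈ segment ℝ (z i) (z i')) (hx' : x ∈ segment ℝ (z j) (z j')) :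
    ∃ m, (m = i ∨ m = i') ∧ (m = j ∨ m = j') ∧ x = z m := by
  wlog hij : i < j ∨ (i = j ∧ i' < j') generalizing i i' j j'
  · obtain ⟨m, h1, h2, h3⟩ := this hjj hii hj0 hj1 hi0 hi1 (by omega) hx' hx (by omega)
    exact ⟨m, h2, h1, h3⟩
  obtain ⟨φ, c, -, h0, h1, hlt, hgt⟩ := hz.line j hj0 (by omega)
  rcases hij with hij | ⟨rfl, hij⟩
  · have hle : φ (z i') ≤ c := by
      rcases lt_trichotomy i' j with h | rfl | h
      · exact (hlt _ h).le
      · exact h0.le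
      · obtain rfl : i' = j + 1 := by omega
        exact h1.le
    have hge : c ≤ φ x := by
      have h2 : c ≤ φ (z j') := by
        rcases hjj with rfl | rfl
        · exact h1.ge
        · exact (hgt _ (by omega)).le
      exact le_of_mem_strip (d := 0) (segment_subset_strip _ _ _ hx') (by simp) h0.ge h2
    obtain ⟨rfl, h3⟩ := eq_right_of_mem_segment hx (hlt _ hij) hle hge
    have hi'j : i' = j ∨ i' = j + 1 := by
      by_contra h
      exact absurd (hlt i' (by omega)) (by rw [h3]; exact lt_irrefl _)
    rcases hi'j with rfl | rfl
    · exact ⟨i', by simp⟩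
    · rcases hjj with rfl | rfl
      · exact ⟨j + 1, by simp⟩
      · rw [segment_symm] at hx'
        have := (eq_right_of_mem_segment' hx' (hgt _ (by omega)) h0.ge h3.le).1
        exact absurd this.symm (hz.ne_of_lt (by omega) (by omega) (by omega))
  · obtain rfl : i' = i + 1 := by omega
    obtain rfl : j' = i + 2 := by omega
    rw [segment_symm] at hx'
    have := (eq_right_of_mem_segment' hx' (hgt _ (by omega)) h0.ge
      (le_of_mem_segment hx h0.le h1.le)).1
    exact ⟨i, by simp, by simp, this⟩

lemma strip_inter (hz : IsZigzag d lo hi z) {i i' j : ℤ} {x : Plane}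
    (hii : i' = i + 1 ∨ i' = i + 2) (hi0 : lo ≤ i) (hi1 : i' ≤ hi) (hj0 : lo ≤ j)
    (hj1 : j + 2 ≤ hi) (hx : x ∈ segment ℝ (z i) (z i'))
    (hx' : x ∈ strip (z j) (z (j + 2)) d) : x ∈ segment ℝ (z j) (z (j + 2)) := by
  obtain ⟨φ, c, hd, h0, h1, hlt, hgt⟩ := hz.line j hj0 (by omega)
  obtain ⟨ψ, k, kd, k0, k2, klt⟩ := hz.wall j hj0 (by omega)
  have hxφ : c ≤ φ x := le_of_mem_strip hx' hd.le h0.ge (hgt _ (by omega)).le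
  have hxψ : k ≤ ψ x := le_of_mem_strip hx' kd.ge k0.le k2.ge
  have key : x = z j ∨ x = z (j + 2) → x ∈ segment ℝ (z j) (z (j + 2)) := by
    rintro (rfl | rfl)
    · exact left_mem_segment ..
    · exact right_mem_segment ..
  rcases lt_trichotomy i j with hij | rfl | hij
  · by_cases hi'j : i' ≤ j
    · have hle : φ (z i') ≤ c := by
        rcases hi'j.lt_or_eq with h | rfl
        · exact (hlt _ h).le
        · exact h0.le
      obtain ⟨rfl, h3⟩ := eq_right_of_mem_segment hx (hlt _ hij) hle hxφ
      have : i' = j := by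
        by_contra h
        exact absurd (hlt i' (by omega)) (by rw [h3]; exact lt_irrefl _)
      exact key (Or.inl (by rw [this]))
    · have h2 := klt i (by omega) (by omega) (by omega) (by omega)
      have h3 := klt i' (by omega) (by omega) (by omega) (by omega)
      exact absurd (eq_right_of_mem_segment hx h2 h3.le hxψ).2 h3.ne
  · rcases hii with rfl | rfl
    · rw [strip_symm] at hx'
      exact key (Or.inl (eq_right_of_mem_strip hx' hd (hgt _ (by omega)) h0.ge
        (le_of_mem_segment hx h0.le h1.le)))
    · exact hx
  · by_cases hij2 : i = j + 2
    · subst hij2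
      rw [segment_symm] at hx
      exact key (Or.inr (eq_right_of_mem_segment hx
        (klt i' (by omega) (by omega) (by omega) (by omega)) k2.le hxψ).1)
    · have h2 := klt i (by omega) (by omega) (by omega) (by omega)
      by_cases hi'j : i' = j + 2
      · subst hi'j
        exact key (Or.inr (eq_right_of_mem_segment hx h2 k2.le hxψ).1)
      · have h3 := klt i' (by omega) (by omega) (by omega) (by omega)
        exact absurd (eq_right_of_mem_segment hx h2 h3.le hxψ).2 h3.ne

end IsZigzag

/-- The zigzag whose even points `o + kδ e + (h + kc) d` move away from the wall through `o`
and whose odd points `o + (D - kδ) e + (M + kc) d` approach it. -/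
def zigzag (o e d : Plane) (D M h δ c : ℝ) (n : ℤ) : Plane :=
  if Even n then o + ((n / 2 : ℤ) * δ) • e + (h + (n / 2 : ℤ) * c) • d
  else o + (D - (n / 2 : ℤ) * δ) • e + (M + (n / 2 : ℤ) * c) • d

section zigzag

variable (o e d : Plane) (D M h δ c : ℝ)

lemma zigzag_even (k : ℤ) :
    zigzag o e d D M h δ c (2 * k) = o + (k * δ) • e + (h + k * c) • d := by
  have : 2 * k / 2 = k := by omega
  simp [zigzag, this]

lemma zigzag_odd (k : ℤ) :
    zigzag o e d D M h δ c (2 * k + 1) = o + (D - k * δ) • e + (M + k * c) • d := by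
  have : (2 * k + 1) / 2 = k := by omega
  simp [zigzag, this]

variable {o e d D M h δ c}

/-- Coordinate functionals dual to an orthonormal frame. -/
lemma exists_dual_frame (he : ‖e‖ = 1) (hd : ‖d‖ = 1) (hed : inner ℝ e d = 0) :
    ∃ ξ η : Plane →ₗ[ℝ] ℝ, ξ e = 1 ∧ ξ d = 0 ∧ η e = 0 ∧ η d = 1 := by
  refine ⟨(innerSL ℝ e).toLinearMap, (innerSL ℝ d).toLinearMap, ?_, ?_, ?_, ?_⟩
  · simp [he]
  · simp [hed]
  · simp [real_inner_comm, hed]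
  · simp [hd]

lemma isZigzag_zigzag {hi : ℤ} (he : ‖e‖ = 1) (hd : ‖d‖ = 1) (hed : inner ℝ e d = 0)
    (hδ : 0 < δ) (hc : 0 < c) (hD : hi * δ < D) (hM : h + c ≤ M)
    (hDM : (M - h) * δ < (D - hi * δ) * c) :
    IsZigzag d (-1) hi (zigzag o e d D M h δ c) := by
  obtain ⟨ξ, η, h1, h2, h3, h4⟩ := exists_dual_frame he hd hed
  have even (k : ℤ) := zigzag_even o e d D M h δ c k
  have odd (k : ℤ) := zigzag_odd o e d D M h δ c k
  have cross (X Y : ℝ) (k l : ℤ) (hX : 0 < X) (hY : 0 ≤ Y) (hXY : Y * δ < X * c)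
      (hXe : X = D - (k + l) * δ) (hYe : Y = M - h + (l - k) * c) :
      ∃ (φ : Plane →ₗ[ℝ] ℝ) (t : ℝ), 0 < φ d ∧
        (∀ m : ℤ, φ (zigzag o e d D M h δ c (2 * m)) = t + (m - k) * (X * c - Y * δ)) ∧
        ∀ m : ℤ, φ (zigzag o e d D M h δ c (2 * m + 1)) = t + (m - l) * (X * c + Y * δ) := by
    refine ⟨X • η - Y • ξ, (X • η - Y • ξ) (zigzag o e d D M h δ c (2 * k)), ?_, ?_, ?_⟩
    · simpa [h2, h4] using hX
    · intro m
      simp [even, h1, h2, h3, h4]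
      ring
    · intro m
      simp [even, odd, h1, h2, h3, h4]
      rw [hXe, hYe]
      ring
  have line (j k l : ℤ) (hj : j ≤ hi) (hkl : k + l = j) (hl : l = k ∨ l = k - 1) :
      ∃ (φ : Plane →ₗ[ℝ] ℝ) (t : ℝ), 0 < φ d ∧
        ∀ n m : ℤ, n = 2 * m ∨ n = 2 * m + 1 →
        ((n < j → φ (zigzag o e d D M h δ c n) < t) ∧
        (n = j → φ (zigzag o e d D M h δ c n) = t) ∧
        (n = j + 1 → φ (zigzag o e d D M h δ c n) = t) ∧
        (j + 1 < n → t < φ (zigzag o e d D M h δ c n))) := by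
    have hj' : (j : ℝ) ≤ hi := by exact_mod_cast hj
    have hkl' : (k : ℝ) + l = j := by exact_mod_cast hkl
    have hX : D - hi * δ ≤ D - (k + l) * δ := by rw [hkl']; nlinarith
    have hYl : (l : ℝ) - k ≤ 0 ∧ -1 ≤ (l : ℝ) - k := by
      rcases hl with rfl | rfl <;> push_cast <;> constructor <;> linarith
    have hXp : 0 < D - (k + l) * δ := by linarith
    have hYp : 0 ≤ M - h + (l - k) * c := by nlinarith
    have hXY : (M - h + (l - k) * c) * δ < (D - (k + l) * δ) * c := by
      have a1 : (M - h + (l - k) * c) * δ ≤ (M - h) * δ := by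
        gcongr; nlinarith
      have a2 : (D - hi * δ) * c ≤ (D - (k + l) * δ) * c := by gcongr
      linarith
    obtain ⟨φ, t, p0, p1, p2⟩ := cross _ _ k l hXp hYp hXY rfl rfl
    set A := (D - (k + l) * δ) * c - (M - h + (l - k) * c) * δ
    set B := (D - (k + l) * δ) * c + (M - h + (l - k) * c) * δ
    have hA : 0 < A := by simp only [A]; linarith
    have hB : 0 < B := by simp only [A, B] at *; nlinarith
    refine ⟨φ, t, p0, ?_⟩
    rintro n m (rfl | rfl)
    · rw [p1]
      refine ⟨fun h => ?_, fun h => ?_, fun h => ?_, fun h => ?_⟩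
      · have : (m : ℝ) < k := by exact_mod_cast (by omega : m < k)
        nlinarith
      · have : m = k := by omega
        simp [this]
      · have : m = k := by omega
        simp [this]
      · have : (k : ℝ) < m := by exact_mod_cast (by omega : k < m)
        nlinarith
    · rw [p2]
      refine ⟨fun h => ?_, fun h => ?_, fun h => ?_, fun h => ?_⟩
      · have : (m : ℝ) < l := by exact_mod_cast (by omega : m < l)
        nlinarith
      · have : m = l := by omega
        simp [this]
      · have : m = l := by omega
        simp [this]
      · have : (l : ℝ) < m := by exact_mod_cast (by omega : l < m)
        nlinarith
  refine ⟨fun j _ hj => ?_, fun j hj0 hj => ?_⟩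
  · obtain ⟨φ, t, p0, p⟩ := line j ((j + 1) / 2) (j / 2) hj (by omega) (by omega)
    have p' (n : ℤ) := p n (n / 2) (by omega)
    exact ⟨φ, t, p0, (p' j).2.1 rfl, (p' _).2.2.1 rfl, fun m hm => (p' m).1 hm,
      fun m hm => (p' m).2.2.2 hm⟩
  · have far (k l : ℤ) (h : k + l ≤ hi) : 0 < D - (k + l) * δ := by
      have : ((k : ℝ) + l) ≤ hi := by exact_mod_cast h
      nlinarith
    rcases Int.even_or_odd' j with ⟨k, rfl | rfl⟩
    · refine ⟨-ξ, (-ξ) (zigzag o e d D M h δ c (2 * k + 2)), by simp [h2], ?_, rfl, ?_⟩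
      · rw [show 2 * k + 2 = 2 * (k + 1) by ring]
        simp [even, h1, h2]
        linarith
      · intro m hm hm' hm1 hm2
        rw [show 2 * k + 2 = 2 * (k + 1) by ring]
        rcases Int.even_or_odd' m with ⟨l, rfl | rfl⟩
        · have : (k : ℝ) + 1 < l := by exact_mod_cast (by omega : k + 1 < l)
          simp [even, h1, h2]
          nlinarith
        · have := far (k + 1) l (by omega)
          simp [even, odd, h1, h2]
          push_cast at this
          linarith
    · refine ⟨ξ, ξ (zigzag o e d D M h δ c (2 * k + 1 + 2)), h2, ?_, rfl, ?_⟩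
      · rw [show 2 * k + 1 + 2 = 2 * (k + 1) + 1 by ring]
        simp [odd, h1, h2]
        linarith
      · intro m hm hm' hm1 hm2
        rw [show 2 * k + 1 + 2 = 2 * (k + 1) + 1 by ring]
        rcases Int.even_or_odd' m with ⟨l, rfl | rfl⟩
        · have := far (k + 1) l (by omega)
          simp [even, odd, h1, h2]
          push_cast at this
          linarith
        · have : (k : ℝ) + 1 < l := by exact_mod_cast (by omega : k + 1 < l)
          simp [odd, h1, h2]
          nlinarith

end zigzag

/-! ### Vertices and edges of the chain graph -/

section chain

variable {s t : ℤ}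

lemma cw_one : cw s t 1 = cu s t 1 := by simp [cw, cu]

lemma exists_cu_or_cw (hs : s ≤ 0) (ht : 0 ≤ t) (v : CVert s t) :
    (∃ n, 0 ≤ n ∧ n ≤ t + 1 ∧ v = cu s t n) ∨ ∃ n, 0 ≤ n ∧ n ≤ -s ∧ v = cw s t (-n) := by
  rcases v with (_ | _) | ⟨i, h1, h2, h3⟩
  · exact Or.inr ⟨0, le_rfl, by omega, by simp [cw]⟩
  · exact Or.inl ⟨0, le_rfl, by omega, by simp [cu]⟩
  · by_cases hi : 0 < i
    · exact Or.inl ⟨i, hi.le, h2, by simp [cu, cv, h1, h2, h3]⟩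
    · exact Or.inr ⟨-i, by omega, by omega, by simp [cw, cv, h1, h2, h3]⟩

lemma adj_of_tri {x y : CVert s t} (i : ℤ) (hi : s ≤ i) (hi' : i ≤ t) (hxy : x ≠ y)
    (hx : x ∈ chainTri s t i) (hy : y ∈ chainTri s t i) : (chainGraph s t).Adj x y :=
  ⟨hxy, Or.inl ⟨i, hi, hi', hx, hy⟩⟩

lemma chainTri_pos {i : ℤ} (hi : 0 < i) :
    chainTri s t i = {cu s t (i - 1), cu s t i, cu s t (i + 1)} := by
  have h1 : i ≠ 0 := by omega
  have h2 : i + 1 ≠ 0 := by omega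
  simp [chainTri, hi, h1, h2, cu]

lemma chainTri_neg {i : ℤ} (hi : i < 0) :
    chainTri s t i = {cw s t i, cw s t (i + 1), cw s t (i + 2)} := by
  have h1 : i ≠ 0 := by omega
  simp [chainTri, hi.le, h1, cw]

/-- An edge is `{a, b}`, or joins two nearby vertices of the right zigzag `b, v₁, v₂, …`, or joins
two nearby vertices of the left zigzag `v₁, a, v₋₁, v₋₂, …`. -/
def IsChainEdge (s t : ℤ) (e : Sym2 (CVert s t)) : Prop :=
  e = s(cw s t (-0), cu s t 0) ∨
    (∃ i i', (i' = i + 1 ∨ i' = i + 2) ∧ 0 ≤ i ∧ i' ≤ t + 1 ∧ e = s(cu s t i, cu s t i')) ∨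
    ∃ i i', (i' = i + 1 ∨ i' = i + 2) ∧ -1 ≤ i ∧ i' ≤ -s ∧
      e = s(cw s t (-i), cw s t (-i'))

lemma isChainEdge_of_mem_edgeSet {e : Sym2 (CVert s t)} (he : e ∈ (chainGraph s t).edgeSet) :
    IsChainEdge s t e := by
  induction e with | _ x y
  rw [SimpleGraph.mem_edgeSet] at he
  obtain ⟨hxy, h⟩ := he
  obtain ⟨i, hi, hi', hx, hy⟩ : ∃ i : ℤ, s ≤ i ∧ i ≤ t ∧ x ∈ chainTri s t i ∧
      y ∈ chainTri s t i := by
    rcases h with h | ⟨i, h1, h2, h3, h4⟩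
    · exact h
    · exact ⟨i, h1, h2, h4, h3⟩
  have swap {u v : CVert s t} (h : IsChainEdge s t s(u, v)) : IsChainEdge s t s(v, u) :=
    Sym2.eq_swap ▸ h
  have ha : (Sum.inl false : CVert s t) = cw s t (-0) := by simp [cw]
  have hb : (Sum.inl true : CVert s t) = cu s t 0 := by simp [cu]
  have hR (j j' : ℤ) (hj : j' = j + 1 ∨ j' = j + 2) (h0 : 0 ≤ j) (h1 : j' ≤ t + 1) :
      IsChainEdge s t s(cu s t j, cu s t j') := Or.inr (Or.inl ⟨j, j', hj, h0, h1, rfl⟩)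
  have hL (j j' : ℤ) (hj : j' = j + 1 ∨ j' = j + 2) (h0 : -1 ≤ j) (h1 : j' ≤ -s) :
      IsChainEdge s t s(cw s t (-j), cw s t (-j')) := Or.inr (Or.inr ⟨j, j', hj, h0, h1, rfl⟩)
  rcases lt_trichotomy i 0 with hneg | rfl | hpos
  · rw [chainTri_neg hneg, show i = -(-i) by ring, show -(-i) + 1 = -(-i - 1) by ring,
      show -(-i) + 2 = -(-i - 2) by ring] at hx hy
    have h01 := hL (-i - 1) (-i) (by omega) (by omega) (by omega)
    have h02 := hL (-i - 2) (-i) (by omega) (by omega) (by omega)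
    have h12 := hL (-i - 2) (-i - 1) (by omega) (by omega) (by omega)
    rcases hx with rfl | rfl | rfl <;> rcases hy with rfl | rfl | rfl <;>
      first
      | exact absurd rfl hxy
      | exact h01
      | exact h02
      | exact h12
      | exact swap h01
      | exact swap h02
      | exact swap h12
  · have hv : cv s t 1 = cu s t 1 := by simp [cu]
    have hv' : cu s t 1 = cw s t (- (-1)) := by simp [cu, cw]
    simp only [chainTri, if_true, ha, hb, hv] at hx hy
    have h01 := hR 0 1 (by omega) (by omega) (by omega)
    have h02 := hL (-1) 0 (by omega) (by omega) (by omega)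
    rw [← hv'] at h02
    rcases hx with rfl | rfl | rfl <;> rcases hy with rfl | rfl | rfl <;>
      first
      | exact absurd rfl hxy
      | exact Or.inl rfl
      | exact swap (Or.inl rfl)
      | exact h01
      | exact h02
      | exact swap h01
      | exact swap h02
  · rw [chainTri_pos hpos] at hx hy
    have h01 := hR (i - 1) i (by omega) (by omega) (by omega)
    have h02 := hR (i - 1) (i + 1) (by omega) (by omega) (by omega)
    have h12 := hR i (i + 1) (by omega) (by omega) (by omega)
    rcases hx with rfl | rfl | rfl <;> rcases hy with rfl | rfl | rfl <;>
      first
      | exact absurd rfl hxy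
      | exact h01
      | exact h02
      | exact h12
      | exact swap h01
      | exact swap h02
      | exact swap h12

lemma isExtEdge_iff {x y : CVert s t} :
    IsExtEdge s t x y ↔ s(x, y) = s(cw s t (-0), cu s t 0) ∨
      (∃ j, 0 ≤ j ∧ j + 2 ≤ t + 1 ∧ s(x, y) = s(cu s t j, cu s t (j + 2))) ∨
      ∃ j, -1 ≤ j ∧ j + 2 ≤ -s ∧ s(x, y) = s(cw s t (-j), cw s t (-(j + 2))) := by
  refine or_congr (by simp [cu, cw]) (or_congr ⟨?_, ?_⟩ ⟨?_, ?_⟩)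
  · rintro ⟨i, h1, h2, h⟩
    refine ⟨i - 1, by omega, by omega, ?_⟩
    rw [h, show i - 1 + 2 = i + 1 by ring]
    have : i + 1 ≠ 0 := by omega
    simp [cu, this]
  · rintro ⟨j, h1, h2, h⟩
    refine ⟨j + 1, by omega, by omega, ?_⟩
    rw [h, show j + 1 + 1 = j + 2 by ring, show j + 1 - 1 = j by ring]
    have : j + 2 ≠ 0 := by omega
    simp [cu, this]
  · rintro ⟨i, h1, h2, h⟩
    refine ⟨-i - 2, by omega, by omega, ?_⟩
    rw [h, Sym2.eq_swap, show -(-i - 2) = i + 2 by ring, show -(-i - 2 + 2) = i by ring]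
    have : i ≠ 0 := by omega
    simp [cw, this]
  · rintro ⟨j, h1, h2, h⟩
    refine ⟨-(j + 2), by omega, by omega, ?_⟩
    rw [h, Sym2.eq_swap, show -(j + 2) + 2 = -j by ring]
    have : -(j + 2) ≠ 0 := by omega
    simp only [cw, this, if_false]

lemma adj_of_isExtEdge (hs : s ≤ 0) (ht : 0 ≤ t) {x y : CVert s t} (hne : x ≠ y)
    (h : IsExtEdge s t x y) : (chainGraph s t).Adj x y := by
  have aux {u v : CVert s t} (i : ℤ) (hi : s ≤ i) (hi' : i ≤ t) (h : s(x, y) = s(u, v))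
      (hu : u ∈ chainTri s t i) (hv : v ∈ chainTri s t i) : (chainGraph s t).Adj x y := by
    rcases Sym2.eq_iff.1 h with ⟨rfl, rfl⟩ | ⟨rfl, rfl⟩
    · exact adj_of_tri i hi hi' hne hu hv
    · exact adj_of_tri i hi hi' hne hv hu
  rcases h with h | ⟨i, h1, h2, h⟩ | ⟨i, h1, h2, h⟩
  · exact aux 0 hs ht h (by simp [chainTri]) (by simp [chainTri])
  · have h0 : 0 < i := by omega
    exact aux i (by omega) h2 h (by simp [chainTri, h0, h0.ne']) (by simp [chainTri, h0, h0.ne'])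
  · have h0 : i < 0 := by omega
    exact aux i h1 (by omega) h (by simp [chainTri, h0.ne, h0.not_gt])
      (by simp [chainTri, h0.ne, h0.not_gt])

lemma exists_chainGraph_adj (hs : s ≤ 0) (ht : 0 ≤ t) (v : CVert s t) :
    ∃ w, (chainGraph s t).Adj v w := by
  have hi (i : ℤ) (h : s ≤ i ∧ i ≤ t + 1 ∧ i ≠ 0) :
      (Sum.inr ⟨i, h⟩ : CVert s t) = cv s t i := by simp [cv, h]
  rcases v with (_ | _) | ⟨i, h⟩
  · exact ⟨Sum.inl true, adj_of_tri 0 hs ht (by simp) (by simp [chainTri]) (by simp [chainTri])⟩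
  · exact ⟨Sum.inl false, adj_of_tri 0 hs ht (by simp) (by simp [chainTri]) (by simp [chainTri])⟩
  · rcases lt_trichotomy i 0 with h0 | h0 | h0
    · by_cases h2 : i = -1
      · subst h2
        refine ⟨Sum.inl false, adj_of_tri (-1) h.1 (by omega) (by simp) ?_ ?_⟩
        · simp [chainTri, hi]
        · simp [chainTri, cw]
      · refine ⟨Sum.inr ⟨i + 1, by omega⟩, adj_of_tri i h.1 (by omega) (by simp) ?_ ?_⟩
        · simp [chainTri, hi, h0.ne, h0.not_gt]
        · have : i + 1 ≠ 0 := by omega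
          simp [chainTri, hi, h0.ne, h0.not_gt, cw, this]
    · omega
    · by_cases h2 : i = 1
      · subst h2
        exact ⟨Sum.inl true, adj_of_tri 0 hs ht (by simp) (by simp [chainTri, hi])
          (by simp [chainTri])⟩
      · have h3 : 1 < i := by omega
        have h4 : i - 1 ≠ 0 := by omega
        refine ⟨Sum.inr ⟨i - 1, by omega⟩,
          adj_of_tri (i - 1) (by omega) (by omega) (by simp; omega) ?_ ?_⟩
        · simp [chainTri, hi, h3, h4]
        · simp [chainTri, hi, h3, h4]

end chain

/-! ### Drawings made of two zigzags -/

/-- The segment of an edge in a drawing. -/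
def edgeSeg {V : Type} (ρ : V → Plane) (e : Sym2 V) : Set Plane :=
  Sym2.lift ⟨fun u v => segment ℝ (ρ u) (ρ v), fun u v => segment_symm ℝ (ρ u) (ρ v)⟩ e

/-- The strip over the segment of an edge in a drawing. -/
def edgeStrip {V : Type} (ρ : V → Plane) (d : Plane) (e : Sym2 V) : Set Plane :=
  Sym2.lift ⟨fun u v => strip (ρ u) (ρ v) d, fun u v => strip_symm (ρ u) (ρ v) d⟩ e

/-- A drawing of the chain graph that consists of two zigzags, separated by a line parallel to `d`
through their common point `v₁`, above the line through `a` and `b`. -/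
structure IsZigzagDrawing (s t : ℤ) (d : Plane) (zL zR : ℤ → Plane) (ρ : CVert s t → Plane) :
    Prop where
  left : IsZigzag d (-1) (-s) zL
  right : IsZigzag d (-1) (t + 1) zR
  map_cu : ∀ n, 0 ≤ n → n ≤ t + 1 → ρ (cu s t n) = zR n
  map_cw : ∀ n, -1 ≤ n → n ≤ -s → ρ (cw s t (-n)) = zL n
  apex : zL (-1) = zR 1
  side : ∃ (φ : Plane →ₗ[ℝ] ℝ) (c : ℝ), φ d = 0 ∧ φ (zR 1) = c ∧
    (∀ n, 0 ≤ n → n ≤ t + 1 → n ≠ 1 → c < φ (zR n)) ∧ ∀ n, 0 ≤ n → n ≤ -s → φ (zL n) < c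
  base : ∃ (φ : Plane →ₗ[ℝ] ℝ) (c : ℝ), 0 < φ d ∧ φ (zL 0) = c ∧ φ (zR 0) = c ∧
    (∀ n, 1 ≤ n → n ≤ t + 1 → c < φ (zR n)) ∧ ∀ n, 1 ≤ n → n ≤ -s → c < φ (zL n)

namespace IsZigzagDrawing

variable {s t : ℤ} {d : Plane} {zL zR : ℤ → Plane} {ρ : CVert s t → Plane}

lemma injective (h : IsZigzagDrawing s t d zL zR ρ) (hs : s ≤ 0) (ht : 0 ≤ t) :
    Function.Injective ρ := by
  obtain ⟨φ, c, -, h1, hR, hL⟩ := h.side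
  have cross (n m : ℤ) (hn : 0 ≤ n) (hn' : n ≤ t + 1) (hm : 0 ≤ m) (hm' : m ≤ -s) :
      zR n ≠ zL m := by
    intro heq
    have h2 := hL m hm hm'
    rw [← heq] at h2
    by_cases h3 : n = 1
    · subst h3
      exact h2.ne h1
    · exact lt_asymm h2 (hR n hn hn' h3)
  intro v w hvw
  rcases exists_cu_or_cw hs ht v with ⟨n, hn, hn', rfl⟩ | ⟨n, hn, hn', rfl⟩ <;>
    rcases exists_cu_or_cw hs ht w with ⟨m, hm, hm', rfl⟩ | ⟨m, hm, hm', rfl⟩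
  · rw [h.map_cu n hn hn', h.map_cu m hm hm'] at hvw
    rw [h.right.eq_of_eq (by omega) hn' (by omega) hm' hvw]
  · rw [h.map_cu n hn hn', h.map_cw m (by omega) hm'] at hvw
    exact absurd hvw (cross n m hn hn' hm hm')
  · rw [h.map_cw n (by omega) hn', h.map_cu m hm hm'] at hvw
    exact absurd hvw.symm (cross m n hm hm' hn hn')
  · rw [h.map_cw n (by omega) hn', h.map_cw m (by omega) hm'] at hvw
    rw [h.left.eq_of_eq (by omega) hn' (by omega) hm' hvw]

/-- A line parallel to `d` through `v₁` separates the two zigzags. -/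
lemma exists_side (h : IsZigzagDrawing s t d zL zR ρ) :
    ∃ (φ : Plane →ₗ[ℝ] ℝ) (c : ℝ), φ d = 0 ∧
      (∀ n, 0 ≤ n → n ≤ t + 1 → c ≤ φ (zR n) ∧ (n = 1 ↔ φ (zR n) = c)) ∧
      ∀ n, -1 ≤ n → n ≤ -s → φ (zL n) ≤ c ∧ (n = -1 ↔ φ (zL n) = c) := by
  obtain ⟨φ, c, h0, h1, hR, hL⟩ := h.side
  refine ⟨φ, c, h0, fun n hn hn' => ?_, fun n hn hn' => ?_⟩
  · by_cases h3 : n = 1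
    · subst h3
      simp [h1]
    · have := hR n hn hn' h3
      exact ⟨this.le, by simp [h3, this.ne']⟩
  · by_cases h3 : n = -1
    · subst h3
      simp [h.apex, h1]
    · have := hL n (by omega) hn'
      exact ⟨this.le, by simp [h3, this.ne]⟩

/-- All vertices other than `a` and `b` lie above the line through `a` and `b`. -/
lemma exists_base (h : IsZigzagDrawing s t d zL zR ρ) (ht : 0 ≤ t) :
    ∃ (φ : Plane →ₗ[ℝ] ℝ) (c : ℝ), 0 < φ d ∧
      (∀ n, 0 ≤ n → n ≤ t + 1 → c ≤ φ (zR n) ∧ (n = 0 ↔ φ (zR n) = c)) ∧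
      ∀ n, -1 ≤ n → n ≤ -s → c ≤ φ (zL n) ∧ (n = 0 ↔ φ (zL n) = c) := by
  obtain ⟨φ, c, h0, h1, h2, hR, hL⟩ := h.base
  refine ⟨φ, c, h0, fun n hn hn' => ?_, fun n hn hn' => ?_⟩
  · by_cases h3 : n = 0
    · subst h3
      simp [h2]
    · have := hR n (by omega) hn'
      exact ⟨this.le, by simp [h3, this.ne']⟩
  · by_cases h3 : n = 0
    · subst h3
      simp [h1]
    · have : c < φ (zL n) := by
        by_cases h4 : n = -1
        · subst h4
          rw [h.apex]
          exact hR 1 le_rfl (by omega)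
        · exact hL n (by omega) hn'
      exact ⟨this.le, by simp [h3, this.ne']⟩

lemma edgeSeg_inter (h : IsZigzagDrawing s t d zL zR ρ) (hs : s ≤ 0) (ht : 0 ≤ t)
    {e f : Sym2 (CVert s t)} (he : IsChainEdge s t e) (hf : IsChainEdge s t f) (hef : e ≠ f)
    {x : Plane} (hx : x ∈ edgeSeg ρ e) (hx' : x ∈ edgeSeg ρ f) :
    ∃ w, w ∈ e ∧ w ∈ f ∧ x = ρ w := by
  obtain ⟨φ, c, hd, hR, hL⟩ := h.exists_base ht
  obtain ⟨ψ, k, -, kR, kL⟩ := h.exists_side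
  have h0 := h.map_cw 0 (by omega) (by omega)
  have h0' := h.map_cu 0 (by omega) (by omega)
  have hLR {i i' j j' : ℤ} (hii : i' = i + 1 ∨ i' = i + 2) (hi : 0 ≤ i) (hi' : i' ≤ t + 1)
      (hjj : j' = j + 1 ∨ j' = j + 2) (hj : -1 ≤ j) (hj' : j' ≤ -s)
      (hx : x ∈ segment ℝ (zR i) (zR i')) (hx' : x ∈ segment ℝ (zL j) (zL j')) :
      (i = 1 ∨ i' = 1) ∧ j = -1 ∧ x = zR 1 := by
    have h1 := kR i hi (by omega)
    have h2 := kR i' (by omega) hi'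
    have h3 := kL j hj (by omega)
    have h4 := kL j' (by omega) hj'
    have h4' : ψ (zL j') < k := lt_of_le_of_ne h4.1 fun hh => by have := h4.2.2 hh; omega
    have hle : k ≤ ψ x :=
      le_of_mem_strip (d := 0) (segment_subset_strip _ _ _ hx) (by simp) h1.1 h2.1
    rw [segment_symm] at hx'
    obtain ⟨h5, h6⟩ := eq_right_of_mem_segment hx' h4' h3.1 hle
    obtain rfl := h3.2.2 h6
    refine ⟨?_, rfl, h5.trans h.apex⟩
    by_contra hne
    have h1' : k < ψ (zR i) := lt_of_le_of_ne h1.1 fun hh => hne (Or.inl (h1.2.2 hh.symm))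
    have := (eq_right_of_mem_segment' hx h1' h2.1 (h5 ▸ h6.le)).2
    exact hne (Or.inr (h2.2.2 this))
  have hbase {z : ℤ → Plane} {i i' : ℤ} (hii : i' = i + 1 ∨ i' = i + 2)
      (hi : c ≤ φ (z i) ∧ (i = 0 ↔ φ (z i) = c)) (hi' : c ≤ φ (z i') ∧ (i' = 0 ↔ φ (z i') = c))
      (hx : x ∈ segment ℝ (z i) (z i')) (hx' : x ∈ segment ℝ (zL 0) (zR 0)) :
      (i = 0 ∨ i' = 0) ∧ x = z 0 := by
    have hle : φ x ≤ c := le_of_mem_segment hx' ((hL 0 (by omega) (by omega)).2.1 rfl).le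
      ((hR 0 (by omega) (by omega)).2.1 rfl).le
    by_cases hi0 : i = 0
    · subst hi0
      have : c < φ (z i') := lt_of_le_of_ne hi'.1 fun hh => by have := hi'.2.2 hh.symm; omega
      rw [segment_symm] at hx
      exact ⟨Or.inl rfl, (eq_right_of_mem_segment' hx this hi.1 hle).1⟩
    · have : c < φ (z i) := lt_of_le_of_ne hi.1 fun hh => hi0 (hi.2.2 hh.symm)
      obtain ⟨h5, h6⟩ := eq_right_of_mem_segment' hx this hi'.1 hle
      obtain rfl := hi'.2.2 h6
      exact ⟨Or.inr rfl, h5⟩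
  rcases he with rfl | ⟨i, i', hii, hi, hi', rfl⟩ | ⟨i, i', hii, hi, hi', rfl⟩ <;>
    rcases hf with rfl | ⟨j, j', hjj, hj, hj', rfl⟩ | ⟨j, j', hjj, hj, hj', rfl⟩ <;>
    simp only [edgeSeg, Sym2.lift_mk, h0, h0'] at hx hx'
  · exact absurd rfl hef
  · rw [h.map_cu j hj (by omega), h.map_cu j' (by omega) hj'] at hx'
    obtain ⟨h1, h2⟩ := hbase hjj (hR j hj (by omega)) (hR j' (by omega) hj') hx' hx
    exact ⟨cu s t 0, by simp, by rcases h1 with rfl | rfl <;> simp, by rw [h0', h2]⟩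
  · rw [h.map_cw j hj (by omega), h.map_cw j' (by omega) hj'] at hx'
    obtain ⟨h1, h2⟩ := hbase hjj (hL j hj (by omega)) (hL j' (by omega) hj') hx' hx
    exact ⟨cw s t (-0), by simp, by rcases h1 with rfl | rfl <;> simp, by rw [h0, h2]⟩
  · rw [h.map_cu i hi (by omega), h.map_cu i' (by omega) hi'] at hx
    obtain ⟨h1, h2⟩ := hbase hii (hR i hi (by omega)) (hR i' (by omega) hi') hx hx'
    exact ⟨cu s t 0, by rcases h1 with rfl | rfl <;> simp, by simp, by rw [h0', h2]⟩
  · rw [h.map_cu i hi (by omega), h.map_cu i' (by omega) hi'] at hx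
    rw [h.map_cu j hj (by omega), h.map_cu j' (by omega) hj'] at hx'
    obtain ⟨m, h1, h2, h3⟩ := h.right.inter hii hjj (by omega) hi' (by omega) hj'
      (by rintro ⟨rfl, rfl⟩; exact hef rfl) hx hx'
    exact ⟨cu s t m, by rcases h1 with rfl | rfl <;> simp, by rcases h2 with rfl | rfl <;> simp,
      by rw [h3, h.map_cu m (by omega) (by omega)]⟩
  · rw [h.map_cu i hi (by omega), h.map_cu i' (by omega) hi'] at hx
    rw [h.map_cw j hj (by omega), h.map_cw j' (by omega) hj'] at hx'
    obtain ⟨h1, rfl, h3⟩ := hLR hii hi hi' hjj hj hj' hx hx'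
    exact ⟨cu s t 1, by rcases h1 with rfl | rfl <;> simp, by simp [cw_one],
      by rw [h3, h.map_cu 1 (by omega) (by omega)]⟩
  · rw [h.map_cw i hi (by omega), h.map_cw i' (by omega) hi'] at hx
    obtain ⟨h1, h2⟩ := hbase hii (hL i hi (by omega)) (hL i' (by omega) hi') hx hx'
    exact ⟨cw s t (-0), by rcases h1 with rfl | rfl <;> simp, by simp, by rw [h0, h2]⟩
  · rw [h.map_cw i hi (by omega), h.map_cw i' (by omega) hi'] at hx
    rw [h.map_cu j hj (by omega), h.map_cu j' (by omega) hj'] at hx'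
    obtain ⟨h1, rfl, h3⟩ := hLR hjj hj hj' hii hi hi' hx' hx
    exact ⟨cu s t 1, by simp [cw_one], by rcases h1 with rfl | rfl <;> simp,
      by rw [h3, h.map_cu 1 (by omega) (by omega)]⟩
  · rw [h.map_cw i hi (by omega), h.map_cw i' (by omega) hi'] at hx
    rw [h.map_cw j hj (by omega), h.map_cw j' (by omega) hj'] at hx'
    obtain ⟨m, h1, h2, h3⟩ := h.left.inter hii hjj (by omega) hi' (by omega) hj'
      (by rintro ⟨rfl, rfl⟩; exact hef rfl) hx hx'
    exact ⟨cw s t (-m), by rcases h1 with rfl | rfl <;> simp,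
      by rcases h2 with rfl | rfl <;> simp, by rw [h3, h.map_cw m (by omega) (by omega)]⟩

lemma isPlanarDrawing (h : IsZigzagDrawing s t d zL zR ρ) (hs : s ≤ 0) (ht : 0 ≤ t) :
    IsPlanarDrawing (chainGraph s t) ρ := by
  have key {u v x y : CVert s t} (huv : (chainGraph s t).Adj u v)
      (hxy : (chainGraph s t).Adj x y) (hne : s(u, v) ≠ s(x, y)) {P : Plane}
      (hP : P ∈ segment ℝ (ρ u) (ρ v)) (hP' : P ∈ segment ℝ (ρ x) (ρ y)) :
      ∃ w, (w = u ∨ w = v) ∧ (w = x ∨ w = y) ∧ P = ρ w := by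
    simpa using h.edgeSeg_inter hs ht (isChainEdge_of_mem_edgeSet (e := s(u, v)) huv)
      (isChainEdge_of_mem_edgeSet (e := s(x, y)) hxy) hne hP hP'
  refine ⟨h.injective hs ht, fun u v w huv hu hv hw => ?_, fun u v x y huv hxy hne => ?_⟩
  · obtain ⟨z, hz⟩ := exists_chainGraph_adj hs ht w
    obtain ⟨w', h1, -, h3⟩ := key huv hz (fun hh => by
      have : w ∈ s(u, v) := hh ▸ Sym2.mem_mk_left w z
      simp [hu, hv] at this) hw (left_mem_segment ..)
    obtain rfl := h.injective hs ht h3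
    rcases h1 with rfl | rfl
    · exact hu rfl
    · exact hv rfl
  · ext P
    refine ⟨fun hP => key huv hxy hne hP.1 hP.2, ?_⟩
    rintro ⟨w, h1, h2, rfl⟩
    constructor
    · rcases h1 with rfl | rfl
      · exact left_mem_segment ..
      · exact right_mem_segment ..
    · rcases h2 with rfl | rfl
      · exact left_mem_segment ..
      · exact right_mem_segment ..

lemma edgeStrip_inter (h : IsZigzagDrawing s t d zL zR ρ) (hs : s ≤ 0) (ht : 0 ≤ t)
    {x y : CVert s t} (hxy : IsExtEdge s t x y)
    (hne : s(x, y) ≠ s(Sum.inl false, (Sum.inl true : CVert s t))) {f : Sym2 (CVert s t)}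
    (hf : IsChainEdge s t f) {P : Plane} (hP : P ∈ edgeStrip ρ d s(x, y)) (hP' : P ∈ edgeSeg ρ f) :
    P ∈ edgeSeg ρ s(x, y) := by
  obtain ⟨φ, c, hd, hR, hL⟩ := h.exists_base ht
  obtain ⟨ψ, k, kd, kR, kL⟩ := h.exists_side
  have h0 := h.map_cw 0 (by omega) (by omega)
  have h0' := h.map_cu 0 (by omega) (by omega)
  have hbase {z : ℤ → Plane} {i : ℤ}
      (hi : c ≤ φ (z i) ∧ (i = 0 ↔ φ (z i) = c))
      (hi' : c ≤ φ (z (i + 2)) ∧ (i + 2 = 0 ↔ φ (z (i + 2)) = c)) (hi0 : -1 ≤ i)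
      (hP : P ∈ strip (z i) (z (i + 2)) d) (hP' : P ∈ segment ℝ (zL 0) (zR 0)) :
      P ∈ segment ℝ (z i) (z (i + 2)) := by
    have hle : φ P ≤ c := le_of_mem_segment hP' ((hL 0 (by omega) (by omega)).2.1 rfl).le
      ((hR 0 (by omega) (by omega)).2.1 rfl).le
    have : c < φ (z (i + 2)) := lt_of_le_of_ne hi'.1 fun hh => by have := hi'.2.2 hh.symm; omega
    rw [strip_symm] at hP
    rw [eq_right_of_mem_strip hP hd this hi.1 hle]
    exact left_mem_segment ..
  rcases isExtEdge_iff.1 hxy with he | ⟨i, hi, hi', he⟩ | ⟨i, hi, hi', he⟩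
  · exact absurd he (by simpa [cu, cw] using hne)
  all_goals
    rw [he] at hP ⊢
    rcases hf with rfl | ⟨j, j', hjj, hj, hj', rfl⟩ | ⟨j, j', hjj, hj, hj', rfl⟩ <;>
    simp only [edgeSeg, edgeStrip, Sym2.lift_mk, h0, h0'] at hP hP' ⊢
  · rw [h.map_cu i hi (by omega), h.map_cu (i + 2) (by omega) hi'] at hP ⊢
    exact hbase (hR i hi (by omega)) (hR _ (by omega) hi') (by omega) hP hP'
  · rw [h.map_cu i hi (by omega), h.map_cu (i + 2) (by omega) hi'] at hP ⊢
    rw [h.map_cu j hj (by omega), h.map_cu j' (by omega) hj'] at hP'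
    exact h.right.strip_inter hjj (by omega) hj' (by omega) hi' hP' hP
  · rw [h.map_cu i hi (by omega), h.map_cu (i + 2) (by omega) hi'] at hP ⊢
    rw [h.map_cw j hj (by omega), h.map_cw j' (by omega) hj'] at hP'
    have h1 := kR i hi (by omega)
    have h2 := kR (i + 2) (by omega) hi'
    have h3 := kL j hj (by omega)
    have h4 := kL j' (by omega) hj'
    have h4' : ψ (zL j') < k := lt_of_le_of_ne h4.1 fun hh => by have := h4.2.2 hh; omega
    rw [segment_symm] at hP'
    obtain ⟨h5, h6⟩ := eq_right_of_mem_segment hP' h4' h3.1 (le_of_mem_strip hP kd.ge h1.1 h2.1)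
    obtain rfl := h3.2.2 h6
    rw [h.apex] at h5 h6
    by_cases hi1 : i = 1
    · subst hi1
      rw [h5]
      exact left_mem_segment ..
    · have h1' : k < ψ (zR i) := lt_of_le_of_ne h1.1 fun hh => hi1 (h1.2.2 hh.symm)
      have h2' : k < ψ (zR (i + 2)) :=
        lt_of_le_of_ne h2.1 fun hh => by have := h2.2.2 hh.symm; omega
      have := (lt_min h1' h2').trans_le
        (le_of_mem_strip hP kd.ge (min_le_left _ _) (min_le_right _ _))
      rw [h5, h6] at this
      exact absurd this (lt_irrefl _)
  · rw [h.map_cw i hi (by omega), h.map_cw (i + 2) (by omega) hi'] at hP ⊢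
    exact hbase (hL i hi (by omega)) (hL _ (by omega) hi') (by omega) hP hP'
  · rw [h.map_cw i hi (by omega), h.map_cw (i + 2) (by omega) hi'] at hP ⊢
    rw [h.map_cu j hj (by omega), h.map_cu j' (by omega) hj'] at hP'
    have h1 := kL i hi (by omega)
    have h2 := kL (i + 2) (by omega) hi'
    have h3 := kR j hj (by omega)
    have h4 := kR j' (by omega) hj'
    have hle : k ≤ ψ P :=
      le_of_mem_strip (d := 0) (segment_subset_strip _ _ _ hP') (by simp) h3.1 h4.1
    have h2' : ψ (zL (i + 2)) < k := lt_of_le_of_ne h2.1 fun hh => by have := h2.2.2 hh; omega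
    obtain ⟨Q, hQ, r, hr, rfl⟩ := hP
    rw [map_add, map_smul, kd, smul_zero, add_zero] at hle
    have hQ' := hQ
    rw [segment_symm] at hQ'
    obtain ⟨h5, h6⟩ := eq_right_of_mem_segment hQ' h2' h1.1 hle
    obtain rfl := h1.2.2 h6
    have hPk : ψ (Q + r • d) ≤ k := by simp [kd, h5, h6]
    have : Q + r • d = zR 1 := by
      by_cases hj1 : j = 1
      · have h4' : k < ψ (zR j') :=
          lt_of_le_of_ne h4.1 fun hh => by have := h4.2.2 hh.symm; omega
        rw [segment_symm] at hP'
        rw [(eq_right_of_mem_segment' hP' h4' h3.1 hPk).1, hj1]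
      · have h3' : k < ψ (zR j) := lt_of_le_of_ne h3.1 fun hh => hj1 (h3.2.2 hh.symm)
        obtain ⟨h7, h8⟩ := eq_right_of_mem_segment' hP' h3' h4.1 hPk
        rw [h7, h4.2.2 h8]
    rw [this, ← h.apex]
    exact left_mem_segment ..
  · rw [h.map_cw i hi (by omega), h.map_cw (i + 2) (by omega) hi'] at hP ⊢
    rw [h.map_cw j hj (by omega), h.map_cw j' (by omega) hj'] at hP'
    exact h.left.strip_inter hjj (by omega) hj' (by omega) hi' hP' hP

end IsZigzagDrawing

/-! ### Metric properties -/

lemma exists_frame {d v : Plane} (hd : ‖d‖ = 1) (hv : ∀ r : ℝ, v ≠ r • d) :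
    ∃ (e : Plane) (W H : ℝ), ‖e‖ = 1 ∧ inner ℝ e d = 0 ∧ 0 < W ∧ v = W • e + H • d := by
  have hd2 : d 0 ^ 2 + d 1 ^ 2 = 1 := by
    have := EuclideanSpace.norm_sq_eq d
    rw [hd] at this
    simpa using this.symm
  set e₀ : Plane := !₂[-d 1, d 0]
  have he₀ : ‖e₀‖ = 1 := by
    rw [EuclideanSpace.norm_eq]
    simp [e₀]
    linarith
  have hed : inner ℝ e₀ d = 0 := by
    simp [e₀, PiLp.inner_apply]
    ring
  set W := -(v 0 * d 1) + v 1 * d 0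
  set H := v 0 * d 0 + v 1 * d 1
  have hvW : v = W • e₀ + H • d := by
    ext i
    fin_cases i
    · simp [e₀, W, H]
      linear_combination (-v 0) * hd2
    · simp [e₀, W, H]
      linear_combination (-v 1) * hd2
  rcases lt_trichotomy W 0 with hW | hW | hW
  · exact ⟨-e₀, -W, H, by simpa using he₀, by simp [hed], by linarith, by simpa using hvW⟩
  · exact absurd (by simpa [hW] using hvW) (hv H)
  · exact ⟨e₀, W, H, he₀, hed, hW, hvW⟩

lemma norm_sq_smul_add_smul {e d : Plane} (he : ‖e‖ = 1) (hd : ‖d‖ = 1) (hed : inner ℝ e d = 0)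
    (a b : ℝ) : ‖a • e + b • d‖ ^ 2 = a ^ 2 + b ^ 2 := by
  rw [norm_add_sq_real, norm_smul, norm_smul, he, hd, real_inner_smul_left,
    real_inner_smul_right, hed]
  simp

lemma segAngle_comm (p q d : Plane) : segAngle p q d = segAngle q p d := min_comm _ _

lemma segAngle_lt_arccos {u v d : Plane} {a : ℝ} (hd : ‖d‖ = 1) (huv : ‖v - u‖ = 1)
    (ha : -1 ≤ a) (h : a < inner ℝ d (v - u)) : segAngle u v d < Real.arccos a := by
  refine (min_le_left _ _).trans_lt ?_
  have hle : inner ℝ d (v - u) ≤ 1 := by simpa [hd, huv] using real_inner_le_norm d (v - u)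
  rw [InnerProductGeometry.angle, hd, huv, mul_one, div_one]
  exact Real.arccos_lt_arccos ha h hle

section zigzag

variable {o e d : Plane} {D M h δ c : ℝ}

lemma exists_zigzag_add_two_sub (j : ℤ) : ∃ σ, (σ = δ ∨ σ = -δ) ∧
    zigzag o e d D M h δ c (j + 2) - zigzag o e d D M h δ c j = σ • e + c • d := by
  rcases Int.even_or_odd' j with ⟨k, rfl | rfl⟩
  · refine ⟨δ, Or.inl rfl, ?_⟩
    rw [show 2 * k + 2 = 2 * (k + 1) by ring, zigzag_even, zigzag_even]
    push_cast
    module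
  · refine ⟨-δ, Or.inr rfl, ?_⟩
    rw [show 2 * k + 1 + 2 = 2 * (k + 1) + 1 by ring, zigzag_odd, zigzag_odd]
    push_cast
    module

lemma lt_dist_zigzag_add_one (hd : ‖d‖ = 1) (hed : inner ℝ e d = 0) (hc : 0 ≤ c) {r : ℝ}
    (hr : r < M - h - c) (j : ℤ) :
    r < dist (zigzag o e d D M h δ c j) (zigzag o e d D M h δ c (j + 1)) := by
  rw [dist_eq_norm]
  have hed' : inner ℝ d e = 0 := by rw [real_inner_comm, hed]
  have hle (v : Plane) : inner ℝ d v ≤ ‖v‖ := by simpa [hd] using real_inner_le_norm d v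
  rcases Int.even_or_odd' j with ⟨k, rfl | rfl⟩
  · rw [norm_sub_rev]
    refine lt_of_lt_of_le ?_ (hle _)
    rw [zigzag_even, zigzag_odd]
    simp [inner_sub_right, inner_add_right, real_inner_smul_right, hed', hd]
    linarith
  · refine lt_of_lt_of_le ?_ (hle _)
    rw [show 2 * k + 1 + 1 = 2 * (k + 1) by ring, zigzag_even, zigzag_odd]
    simp [inner_sub_right, inner_add_right, real_inner_smul_right, hed', hd]
    linarith

end zigzag

lemma mem_strip_of_coord {p e d : Plane} {W H a b : ℝ} (hW : 0 < W) (ha : 0 ≤ a) (haW : a ≤ W)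
    (hb : 0 ≤ W * b - H * a) : p + a • e + b • d ∈ strip p (p + (W • e + H • d)) d := by
  refine ⟨p + (a / W) • (W • e + H • d), ?_, b - H * a / W, ?_, ?_⟩
  · refine ⟨1 - a / W, a / W, ?_, by positivity, by ring, by module⟩
    rw [sub_nonneg, div_le_one hW]
    exact haW
  · rw [sub_nonneg, div_le_iff₀ hW]
    linarith
  · have : (a / W) • W • e = a • e := by rw [smul_smul, div_mul_cancel₀ _ hW.ne']
    rw [smul_add, this]
    module

lemma exists_step {W : ℝ} (hW : 0 < W) (hW1 : W ≤ 1) {n : ℝ} (hn : 2 ≤ n) :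
    ∃ δ c : ℝ, 0 < δ ∧ n * δ = W / 100 ∧ δ ≤ W / 200 ∧ 9 / 10 < c ∧ c ≤ 1 ∧
      δ ^ 2 + c ^ 2 = 1 := by
  have hn0 : 0 < n := by linarith
  have h1 : W / (100 * n) ≤ W / 200 := by gcongr; linarith
  have h0 : 0 < W / (100 * n) := by positivity
  refine ⟨W / (100 * n), √(1 - (W / (100 * n)) ^ 2), h0, by field_simp, h1, ?_, ?_, ?_⟩
  · apply Real.lt_sqrt_of_sq_lt
    nlinarith
  · exact Real.sqrt_le_iff.2 ⟨zero_le_one, by nlinarith⟩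
  · rw [Real.sq_sqrt (by nlinarith)]
    ring

section coordinates

variable {p e d : Plane} {W H δ c : ℝ} {s t : ℤ}

lemma left_coord (hW : 0 < W) (hH : |H| ≤ 1) (hδ : 0 < δ) (hδW : δ ≤ W / 200) (hc : 9 / 10 < c)
    (hN : ((t + 2 - s : ℤ) : ℝ) * δ = W / 100) (ht : 0 ≤ t) (n : ℤ) (hn : -1 ≤ n) (hn' : n ≤ -s) :
    ∃ a b : ℝ, zigzag p e d (W / 2 - δ) (3 + c) 0 δ c n = p + a • e + b • d ∧ 0 ≤ a ∧ a ≤ W ∧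
      (n = 0 ∧ a = 0 ∧ b = 0 ∨ 0 < W * b - H * a) ∧ (n = -1 ∨ a < W / 2) := by
  obtain ⟨hH1, hH2⟩ := abs_le.1 hH
  have bound (k : ℤ) (hk : 2 * k ≤ -s) : (k : ℝ) * δ ≤ W / 100 := by
    rw [← hN]
    have : (k : ℝ) ≤ ((t + 2 - s : ℤ) : ℝ) := by exact_mod_cast (by omega : k ≤ t + 2 - s)
    gcongr
  rcases Int.even_or_odd' n with ⟨k, rfl | rfl⟩
  · have hk0 : (0 : ℝ) ≤ k := by exact_mod_cast (by omega : 0 ≤ k)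
    have := bound k hn'
    refine ⟨k * δ, 0 + k * c, zigzag_even .., by positivity, by linarith, ?_,
      Or.inr (by linarith)⟩
    by_cases hk : k = 0
    · subst hk
      simp
    · have hk1 : (0 : ℝ) < k := by exact_mod_cast (by omega : 0 < k)
      right
      have : 0 < W * c - H * δ := by nlinarith
      nlinarith
  · have hk0 : (0 : ℝ) ≤ k + 1 := by exact_mod_cast (by omega : 0 ≤ k + 1)
    have := bound k (by omega)
    have h1 := mul_nonneg hk0 hδ.le
    refine ⟨W / 2 - δ - k * δ, 3 + c + k * c, zigzag_odd .., by linarith, by linarith,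
      Or.inr ?_, ?_⟩
    · have h2 : 0 ≤ (k + 1) * c := by positivity
      have h3 : H * (W / 2 - δ - k * δ) ≤ W := by nlinarith
      nlinarith
    · by_cases hk : k = -1
      · exact Or.inl (by omega)
      · have hk1 : (0 : ℝ) < k + 1 := by exact_mod_cast (by omega : 0 < k + 1)
        have := mul_pos hk1 hδ
        exact Or.inr (by linarith)

lemma right_coord (hW : 0 < W) (hH : |H| ≤ 1) (hδ : 0 < δ) (hδW : δ ≤ W / 200) (hc : 9 / 10 < c)
    (hN : ((t + 2 - s : ℤ) : ℝ) * δ = W / 100) (hs : s ≤ 0) (n : ℤ) (hn : 0 ≤ n)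
    (hn' : n ≤ t + 1) :
    ∃ a b : ℝ, zigzag (p + W • e) (-e) d (W / 2) 3 H δ c n = p + a • e + b • d ∧ 0 ≤ a ∧ a ≤ W ∧
      (n = 0 ∧ a = W ∧ b = H ∨ 0 < W * b - H * a) ∧ (n = 1 ∨ W / 2 < a) := by
  obtain ⟨hH1, hH2⟩ := abs_le.1 hH
  have bound (k : ℤ) (hk : 2 * k ≤ t + 1) : (k : ℝ) * δ ≤ W / 100 := by
    rw [← hN]
    have : (k : ℝ) ≤ ((t + 2 - s : ℤ) : ℝ) := by exact_mod_cast (by omega : k ≤ t + 2 - s)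
    gcongr
  rcases Int.even_or_odd' n with ⟨k, rfl | rfl⟩
  · have hk0 : (0 : ℝ) ≤ k := by exact_mod_cast (by omega : 0 ≤ k)
    have := bound k hn'
    have h1 := mul_nonneg hk0 hδ.le
    refine ⟨W - k * δ, H + k * c, ?_, by linarith, by linarith, ?_, Or.inr (by linarith)⟩
    · rw [zigzag_even]
      module
    · by_cases hk : k = 0
      · subst hk
        simp
      · have hk1 : (0 : ℝ) < k := by exact_mod_cast (by omega : 0 < k)
        right
        have : 0 < W * c + H * δ := by nlinarith
        nlinarith
  · have hk0 : (0 : ℝ) ≤ k := by exact_mod_cast (by omega : 0 ≤ k)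
    have := bound k (by omega)
    have h1 := mul_nonneg hk0 hδ.le
    refine ⟨W / 2 + k * δ, 3 + k * c, ?_, by linarith, by linarith, Or.inr ?_, ?_⟩
    · rw [zigzag_odd]
      module
    · have h2 : 0 ≤ k * c := by positivity
      have h3 : H * (W / 2 + k * δ) ≤ W := by nlinarith
      nlinarith
    · by_cases hk : k = 0
      · exact Or.inl (by omega)
      · have hk1 : (0 : ℝ) < k := by exact_mod_cast (by omega : 0 < k)
        have := mul_pos hk1 hδ
        exact Or.inr (by linarith)

end coordinates

/-- The drawing of the chain graph given by its right and left zigzags. -/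
def zigzagDrawing (s t : ℤ) (zL zR : ℤ → Plane) : CVert s t → Plane :=
  Sum.elim (fun b => if b then zR 0 else zL 0)
    fun i => if 0 < i.1 then zR i.1 else zL (-i.1)

lemma zigzagDrawing_cu {s t : ℤ} {zL zR : ℤ → Plane} (hs : s ≤ 0) (n : ℤ) (hn : 0 ≤ n)
    (hn' : n ≤ t + 1) : zigzagDrawing s t zL zR (cu s t n) = zR n := by
  by_cases h0 : n = 0
  · simp [h0, cu, zigzagDrawing]
  · have h1 : s ≤ n := by omega
    have h2 : 0 < n := by omega
    simp [cu, cv, zigzagDrawing, h0, h1, h2, hn']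

lemma zigzagDrawing_cw {s t : ℤ} {zL zR : ℤ → Plane} (hs : s ≤ 0) (ht : 0 ≤ t)
    (h : zL (-1) = zR 1) (n : ℤ) (hn : -1 ≤ n) (hn' : n ≤ -s) :
    zigzagDrawing s t zL zR (cw s t (-n)) = zL n := by
  by_cases h0 : n = 0
  · simp [h0, cw, zigzagDrawing]
  · by_cases h1 : n = -1
    · subst h1
      rw [h]
      exact (congrArg _ cw_one).trans (zigzagDrawing_cu hs 1 (by omega) (by omega))
    · have h2 : s ≤ -n := by omega
      have h3 : -n ≤ t + 1 := by omega
      have h4 : ¬ n < 0 := by omega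
      simp [cw, cv, zigzagDrawing, h0, h2, h3, h4]

lemma isZigzagDrawing_zigzagDrawing {p e d : Plane} {W H δ c : ℝ} {s t : ℤ} (hs : s ≤ 0)
    (ht : 0 ≤ t) (he : ‖e‖ = 1) (hd : ‖d‖ = 1) (hed : inner ℝ e d = 0) (hW : 0 < W)
    (hH : |H| ≤ 1) (hδ : 0 < δ) (hδW : δ ≤ W / 200) (hc : 9 / 10 < c) (hc1 : c ≤ 1)
    (hN : ((t + 2 - s : ℤ) : ℝ) * δ = W / 100) :
    IsZigzagDrawing s t d (zigzag p e d (W / 2 - δ) (3 + c) 0 δ c)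
      (zigzag (p + W • e) (-e) d (W / 2) 3 H δ c)
      (zigzagDrawing s t (zigzag p e d (W / 2 - δ) (3 + c) 0 δ c)
        (zigzag (p + W • e) (-e) d (W / 2) 3 H δ c)) := by
  obtain ⟨hH1, hH2⟩ := abs_le.1 hH
  have hsR : (s : ℝ) ≤ 0 := by exact_mod_cast hs
  have htR : (0 : ℝ) ≤ t := by exact_mod_cast ht
  have hN' := hN
  push_cast at hN'
  have hR1 : zigzag (p + W • e) (-e) d (W / 2) 3 H δ c 1 = p + (W / 2) • e + (3 : ℝ) • d := by
    have := zigzag_odd (p + W • e) (-e) d (W / 2) 3 H δ c 0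
    rw [show (2 : ℤ) * 0 + 1 = 1 by ring] at this
    rw [this]
    push_cast
    module
  have hL1 : zigzag p e d (W / 2 - δ) (3 + c) 0 δ c (-1) = p + (W / 2) • e + (3 : ℝ) • d := by
    have := zigzag_odd p e d (W / 2 - δ) (3 + c) 0 δ c (-1)
    rw [show (2 : ℤ) * (-1) + 1 = -1 by ring] at this
    rw [this]
    push_cast
    module
  have hL0 : zigzag p e d (W / 2 - δ) (3 + c) 0 δ c 0 = p := by
    simpa using zigzag_even p e d (W / 2 - δ) (3 + c) 0 δ c 0
  have hR0 : zigzag (p + W • e) (-e) d (W / 2) 3 H δ c 0 = p + W • e + H • d := by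
    simpa using zigzag_even (p + W • e) (-e) d (W / 2) 3 H δ c 0
  have apex := hL1.trans hR1.symm
  obtain ⟨ξ, η, h1, h2, h3, h4⟩ := exists_dual_frame he hd hed
  refine ⟨?_, ?_, fun n => zigzagDrawing_cu hs n, fun n => zigzagDrawing_cw hs ht apex n, apex,
    ⟨ξ, ξ p + W / 2, h2, by simp [hR1, h1, h2], fun n hn hn' hne => ?_, fun n hn hn' => ?_⟩,
    ⟨W • η - H • ξ, W • η p - H • ξ p, by simp [h2, h4, hW], by simp [hL0], ?_,
      fun n hn hn' => ?_, fun n hn hn' => ?_⟩⟩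
  · have hb : -(s : ℝ) * δ ≤ W / 100 := by nlinarith
    apply isZigzag_zigzag he hd hed hδ (by linarith)
    · push_cast
      linarith
    · linarith
    · push_cast
      nlinarith
  · have hb : ((t : ℝ) + 1) * δ ≤ W / 100 := by nlinarith
    apply isZigzag_zigzag (by simpa using he) hd (by simp [hed]) hδ (by linarith)
    · push_cast
      linarith
    · linarith
    · push_cast
      nlinarith
  · obtain ⟨a, b, hab, -, -, -, h | h⟩ := right_coord (p := p) (e := e) (d := d) hW hH hδ hδW hc
      hN hs n hn hn'
    · exact absurd h hne
    · simp [hab, h1, h2, h]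
  · obtain ⟨a, b, hab, -, -, -, h | h⟩ := left_coord (p := p) (e := e) (d := d) hW hH hδ hδW hc
      hN ht n (by omega) hn'
    · omega
    · simp [hab, h1, h2, h]
  · simp [hR0, h1, h2, h3, h4]
    ring
  · obtain ⟨a, b, hab, -, -, h | h, -⟩ := right_coord (p := p) (e := e) (d := d) hW hH hδ hδW hc
      hN hs n (by omega) hn'
    · omega
    · simp [hab, h1, h2, h3, h4]
      linarith
  · obtain ⟨a, b, hab, -, -, h | h, -⟩ := left_coord (p := p) (e := e) (d := d) hW hH hδ hδW hc
      hN ht n (by omega) hn'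
    · omega
    · simp [hab, h1, h2, h3, h4]
      linarith

/-- the chain-drawing lemma.  Given `s ≤ 0 ≤ t`, a unit segment `[p,q]` and
a unit direction `d` not parallel to `q − p` forming an angle less than `arccos(1/4)` with
the segment, the chain `C(s,t)` has a planar straight-line drawing with `a ↦ p`, `b ↦ q`
satisfying: (i) all edge segments lie in the strip `S([p,q], d)`; (ii) every external edge
other than `{a,b}` is not parallel to `d` and its strip meets the drawing only in the edge
itself; (iii) external edges have length `1` and all other edges have length `> 1/2`;
(iv) every external edge forms an angle less than `arccos(1/4)` with `d`. -/
theorem chain_strip_drawing (s t : ℤ) (hs : s ≤ 0) (ht : 0 ≤ t)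
    (p q d : Plane) (hpq : dist p q = 1) (hd : ‖d‖ = 1)
    (hpar : ∀ r : ℝ, q - p ≠ r • d)
    (hang : segAngle p q d < Real.arccos (1 / 4)) :
    ∃ ρ : CVert s t → Plane,
      IsPlanarDrawing (chainGraph s t) ρ ∧
      ρ (Sum.inl false) = p ∧ ρ (Sum.inl true) = q ∧
      (∀ x y : CVert s t, (chainGraph s t).Adj x y →
        segment ℝ (ρ x) (ρ y) ⊆ strip p q d) ∧
      (∀ x y : CVert s t, IsExtEdge s t x y →
        s(x, y) ≠ s(Sum.inl false, (Sum.inl true : CVert s t)) →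
        (∀ r : ℝ, ρ y - ρ x ≠ r • d) ∧
        strip (ρ x) (ρ y) d ∩ drawnEdgeSet (chainGraph s t) ρ =
          segment ℝ (ρ x) (ρ y)) ∧
      (∀ x y : CVert s t, IsExtEdge s t x y → dist (ρ x) (ρ y) = 1) ∧
      (∀ x y : CVert s t, (chainGraph s t).Adj x y → ¬ IsExtEdge s t x y →
        1 / 2 < dist (ρ x) (ρ y)) ∧
      (∀ x y : CVert s t, IsExtEdge s t x y →
        segAngle (ρ x) (ρ y) d < Real.arccos (1 / 4)) := by
  obtain ⟨e, W, H, he, hed, hW, hqp⟩ := exists_frame hd hpar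
  have hWH : W ^ 2 + H ^ 2 = 1 := by
    rw [← norm_sq_smul_add_smul he hd hed, ← hqp, ← dist_eq_norm, dist_comm, hpq, one_pow]
  have hq : q = p + (W • e + H • d) := by rw [← hqp]; abel
  have hW1 : W ≤ 1 := by nlinarith
  have hH : |H| ≤ 1 := abs_le_one_iff_mul_self_le_one.2 (by nlinarith)
  obtain ⟨δ, c, hδ, hN, hδW, hc, hc1, hδc⟩ := exists_step hW hW1
    (n := ((t + 2 - s : ℤ) : ℝ)) (by exact_mod_cast (by omega : 2 ≤ t + 2 - s))
  have hZ := isZigzagDrawing_zigzagDrawing (p := p) hs ht he hd hed hW hH hδ hδW hc hc1 hN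
  have hLc := left_coord (p := p) (e := e) (d := d) hW hH hδ hδW hc hN ht
  have hRc := right_coord (p := p) (e := e) (d := d) hW hH hδ hδW hc hN hs
  have hLstep := exists_zigzag_add_two_sub (o := p) (e := e) (d := d) (D := W / 2 - δ)
    (M := 3 + c) (h := 0) (δ := δ) (c := c)
  have hRstep := exists_zigzag_add_two_sub (o := p + W • e) (e := -e) (d := d) (D := W / 2)
    (M := 3) (h := H) (δ := δ) (c := c)
  have hLdist := lt_dist_zigzag_add_one (o := p) (D := W / 2 - δ) (M := 3 + c) (h := 0) (δ := δ)
    hd hed (by linarith : 0 ≤ c) (by linarith : 1 / 2 < 3 + c - 0 - c)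
  have hRdist := lt_dist_zigzag_add_one (o := p + W • e) (D := W / 2) (M := 3) (h := H) (δ := δ)
    hd (by simpa using hed : inner ℝ (-e) d = 0) (by linarith : 0 ≤ c)
    (by linarith [(abs_le.1 hH).2] : 1 / 2 < 3 - H - c)
  have hL0 : zigzag p e d (W / 2 - δ) (3 + c) 0 δ c 0 = p := by
    simpa using zigzag_even p e d (W / 2 - δ) (3 + c) 0 δ c 0
  have hR0 : zigzag (p + W • e) (-e) d (W / 2) 3 H δ c 0 = q := by
    rw [hq, ← add_assoc]
    simpa using zigzag_even (p + W • e) (-e) d (W / 2) 3 H δ c 0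
  set zL := zigzag p e d (W / 2 - δ) (3 + c) 0 δ c
  set zR := zigzag (p + W • e) (-e) d (W / 2) 3 H δ c
  set ρ := zigzagDrawing s t zL zR
  have ha : ρ (Sum.inl false) = p := by simp [ρ, zigzagDrawing, hL0]
  have hb : ρ (Sum.inl true) = q := by simp [ρ, zigzagDrawing, hR0]
  have hstrip (v : CVert s t) : ρ v ∈ strip p q d := by
    rcases exists_cu_or_cw hs ht v with ⟨n, hn, hn', rfl⟩ | ⟨n, hn, hn', rfl⟩
    · obtain ⟨a, b, hab, ha, haW, h, -⟩ := hRc n hn hn'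
      rw [hZ.map_cu n hn hn', hab, hq]
      refine mem_strip_of_coord hW ha haW ?_
      rcases h with ⟨-, rfl, rfl⟩ | h <;> linarith
    · obtain ⟨a, b, hab, ha, haW, h, -⟩ := hLc n (by omega) hn'
      rw [hZ.map_cw n (by omega) hn', hab, hq]
      refine mem_strip_of_coord hW ha haW ?_
      rcases h with ⟨-, rfl, rfl⟩ | h <;> linarith
  have hext (x y : CVert s t) (hxy : IsExtEdge s t x y) :
      dist (ρ x) (ρ y) = 1 ∧ segAngle (ρ x) (ρ y) d < Real.arccos (1 / 4) ∧
        ∀ r : ℝ, ρ y - ρ x ≠ r • d := by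
    suffices h : ∃ u v, s(x, y) = s(u, v) ∧ dist (ρ u) (ρ v) = 1 ∧
        segAngle (ρ u) (ρ v) d < Real.arccos (1 / 4) ∧ ∀ r : ℝ, ρ v - ρ u ≠ r • d by
      obtain ⟨u, v, huv, h1, h2, h3⟩ := h
      rcases Sym2.eq_iff.1 huv with ⟨rfl, rfl⟩ | ⟨rfl, rfl⟩
      · exact ⟨h1, h2, h3⟩
      · refine ⟨dist_comm (ρ y) (ρ x) ▸ h1, segAngle_comm (ρ y) (ρ x) d ▸ h2, fun r hr => ?_⟩
        exact h3 (-r) (by rw [neg_smul, ← hr]; abel)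
    have key {u v f : Plane} {σ : ℝ} (hf : ‖f‖ = 1) (hfd : inner ℝ f d = 0)
        (hσ : σ = δ ∨ σ = -δ) (huv : v - u = σ • f + c • d) : dist u v = 1 ∧
        segAngle u v d < Real.arccos (1 / 4) ∧ ∀ r : ℝ, v - u ≠ r • d := by
      have hσ2 : σ ^ 2 = δ ^ 2 := by rcases hσ with rfl | rfl <;> ring
      have hn : ‖v - u‖ = 1 := by
        rw [← sq_eq_sq₀ (norm_nonneg _) zero_le_one, huv, norm_sq_smul_add_smul hf hd hfd, hσ2,
          hδc, one_pow]
      refine ⟨by rw [dist_comm, dist_eq_norm, hn], segAngle_lt_arccos hd hn (by norm_num) ?_,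
        fun r hr => ?_⟩
      · have hdf : inner ℝ d f = 0 := by rw [real_inner_comm, hfd]
        rw [huv, inner_add_right, real_inner_smul_right, real_inner_smul_right, hdf,
          real_inner_self_eq_norm_sq, hd]
        linarith
      · have h0 : inner ℝ f (v - u) = σ := by
          rw [huv, inner_add_right, real_inner_smul_right, real_inner_smul_right, hfd,
            real_inner_self_eq_norm_sq, hf]
          ring
        rw [hr, real_inner_smul_right, hfd, mul_zero] at h0
        rcases hσ with rfl | rfl <;> linarith
    rcases isExtEdge_iff.1 hxy with h | ⟨j, hj, hj', h⟩ | ⟨j, hj, hj', h⟩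
    · refine ⟨_, _, h, ?_⟩
      rw [hZ.map_cw 0 (by omega) (by omega), hZ.map_cu 0 le_rfl (by omega), hL0, hR0]
      exact ⟨hpq, hang, hpar⟩
    · obtain ⟨σ, hσ, hστ⟩ := hRstep j
      refine ⟨_, _, h, ?_⟩
      rw [hZ.map_cu j hj (by omega), hZ.map_cu (j + 2) (by omega) hj']
      exact key (by simpa using he) (by simpa using hed) hσ hστ
    · obtain ⟨σ, hσ, hστ⟩ := hLstep j
      refine ⟨_, _, h, ?_⟩
      rw [hZ.map_cw j hj (by omega), hZ.map_cw (j + 2) (by omega) hj']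
      exact key he hed hσ hστ
  refine ⟨ρ, hZ.isPlanarDrawing hs ht, ha, hb, fun x y _ => ?_, fun x y hxy hne => ?_,
    fun x y hxy => (hext x y hxy).1, fun x y hxy hne => ?_, fun x y hxy => (hext x y hxy).2.1⟩
  · exact (convex_strip p q d).segment_subset (hstrip x) (hstrip y)
  · refine ⟨(hext x y hxy).2.2,
      Set.Subset.antisymm ?_ fun P hP => ⟨segment_subset_strip _ _ _ hP, ?_⟩⟩
    · rintro P ⟨hP, hP'⟩
      simp only [drawnEdgeSet, Set.mem_iUnion] at hP'
      obtain ⟨f, hf, hP'⟩ := hP'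
      exact hZ.edgeStrip_inter hs ht hxy hne
        (isChainEdge_of_mem_edgeSet (e := s(f.1, f.2)) hf) hP hP'
    · have hxy' : x ≠ y := by
        rintro rfl
        simpa using (hext x x hxy).1
      simp only [drawnEdgeSet, Set.mem_iUnion]
      exact ⟨(x, y), adj_of_isExtEdge hs ht hxy' hxy, hP⟩
  · have swap {u v : CVert s t} (huv : s(x, y) = s(u, v)) :
        dist (ρ x) (ρ y) = dist (ρ u) (ρ v) := by
      rcases Sym2.eq_iff.1 huv with ⟨rfl, rfl⟩ | ⟨rfl, rfl⟩
      · rfl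
      · exact dist_comm _ _
    rw [isExtEdge_iff] at hne
    rcases isChainEdge_of_mem_edgeSet (e := s(x, y)) hxy with h | ⟨i, i', hii, hi, hi', h⟩ |
      ⟨i, i', hii, hi, hi', h⟩
    · exact absurd (Or.inl h) hne
    · rcases hii with rfl | rfl
      · rw [swap h, hZ.map_cu i hi (by omega), hZ.map_cu (i + 1) (by omega) hi']
        exact hRdist i
      · exact absurd (Or.inr (Or.inl ⟨i, hi, hi', h⟩)) hne
    · rcases hii with rfl | rfl
      · rw [swap h, hZ.map_cw i hi (by omega), hZ.map_cw (i + 1) (by omega) hi']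
        exact hLdist i
      · exact absurd (Or.inr (Or.inr ⟨i, hi, hi', h⟩)) hne
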